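/- The sixth basic cohomology of the Schrödinger-Virasoro conformal algebra with trivial coefficients is two-dimensional: H̃⁶(SV,ℂ) = ℂΩ ⊕ ℂΘ, where Ω is the 6-cochain with Ω_{λ₁,…,λ₆}(L,L,L,Y,Y,M) = (λ₁−λ₂)(λ₁−λ₃)(λ₂−λ₃)(λ₄−λ₅) and zero on all other tuples of generators, and Θ is the 6-cochain with Θ_{λ₁,…,λ₆}(L,L,Y,Y,M,M) = (λ₁−λ₂)(λ₃−λ₄)(λ₅−λ₆) and zero on all other tuples of generators. In particular, Ω and Θ are 6-cocycles, neither is a 6-coboundary, and their classes form a basis of H̃⁶(SV,ℂ). -/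

import Mathlib

/-!
Cochain complex of the Schrödinger–Virasoro conformal algebra
`SV = ℂ[∂]L ⊕ ℂ[∂]Y ⊕ ℂ[∂]M` with coefficients in the trivial module `ℂ_a`.

Since `SV` is a free `ℂ[∂]`-module on the generators `L, Y, M`, and since a
`q`-cochain (a `ℂ`-linear, conformally antilinear map `SV^{⊗q} → ℂ[λ₁,…,λ_q]`)
is uniquely determined by its values on `q`-tuples of generators, we model
cochains as functions from generator tuples to `ℂ[λ₁,…,λ_q]`, subject to the
skew-symmetry condition (simultaneous permutation of the entries and the
variables `λᵢ`).
-/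

namespace SVCA

open MvPolynomial

/-- The generators `L`, `Y`, `M` of the Schrödinger–Virasoro conformal algebra. -/
inductive SVGen : Type
  | L | Y | M
  deriving DecidableEq

open SVGen

/-- The λ-brackets on generators: `SVbrk a b = (x, c₁, c₂)` encodes
`[a_λ b] = (c₁ ∂ + c₂ λ) x`.  Zero brackets are encoded by zero coefficients:
`[L_λ L] = (∂+2λ)L`, `[L_λ Y] = (∂+(3/2)λ)Y`, `[Y_λ L] = ((1/2)∂+(3/2)λ)Y`,
`[Y_λ Y] = (∂+2λ)M`, `[L_λ M] = (∂+λ)M`, `[M_λ L] = λM`, and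
`[Y_λ M] = [M_λ Y] = [M_λ M] = 0`. -/
noncomputable def SVbrk : SVGen → SVGen → SVGen × ℂ × ℂ
  | L, L => (L, 1, 2)
  | L, Y => (Y, 1, 3/2)
  | Y, L => (Y, 1/2, 3/2)
  | Y, Y => (M, 1, 2)
  | L, M => (M, 1, 1)
  | M, L => (M, 0, 1)
  | _, _ => (M, 0, 0)

/-- The space of (not necessarily skew-symmetric) `q`-cochains with trivial
coefficients: functions from `q`-tuples of generators to `ℂ[λ₁,…,λ_q]`. -/
abbrev SVRaw (q : ℕ) := (Fin q → SVGen) → MvPolynomial (Fin q) ℂ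

/-- The `ℂ`-subspace `C̃^q(SV,ℂ)` of `q`-cochains: skew-symmetry with respect to
simultaneous permutations of the arguments and of the variables `λᵢ`. -/
noncomputable def SVCochain (q : ℕ) : Submodule ℂ (SVRaw q) where
  carrier := {c | ∀ (σ : Equiv.Perm (Fin q)) (a : Fin q → SVGen),
      rename σ (c (a ∘ σ)) = ((Equiv.Perm.sign σ : ℤ) : ℂ) • c a}
  add_mem' := by
    intro c c' hc hc' σ a
    simp only [Pi.add_apply, map_add, hc σ a, hc' σ a, smul_add]
  zero_mem' := by intro σ a; simp
  smul_mem' := by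
    intro r c hc σ a
    simp only [Pi.smul_apply, map_smul, hc σ a]
    rw [smul_comm]

/-- The strictly increasing embedding `Fin q → Fin (q+2)` omitting `i` and `j`
(meaningful for `i < j`; junk otherwise). -/
def SVskip {q : ℕ} (i j : Fin (q + 2)) (k : Fin q) : Fin (q + 2) :=
  j.succAbove ((⟨min (i : ℕ) q, Nat.lt_succ_of_le (Nat.min_le_right _ _)⟩ : Fin (q + 1)).succAbove k)

/-- The `(i,j)`-summand of the differential (trivial coefficients):
`(-1)^{i+j} γ_{λᵢ+λⱼ, λ₁, …, λ̂ᵢ, …, λ̂ⱼ, …}([a_{i λᵢ} a_j], a₁, …, âᵢ, …, âⱼ, …)`,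
where `[a_{i λᵢ} a_j] = (c₁∂ + c₂λᵢ)x` and conformal antilinearity in the first
slot (whose variable is `λᵢ+λⱼ`) produces the factor `c₂λᵢ - c₁(λᵢ+λⱼ)`. -/
noncomputable def SVdTerm {q : ℕ} (c : SVRaw (q + 1)) (a : Fin (q + 2) → SVGen)
    (i j : Fin (q + 2)) : MvPolynomial (Fin (q + 2)) ℂ :=
  ((-1 : ℂ) ^ ((i : ℕ) + (j : ℕ))) •
    ((C (SVbrk (a i) (a j)).2.2 * X i - C (SVbrk (a i) (a j)).2.1 * (X i + X j)) *
      aeval (Fin.cons (X i + X j) fun k => X (SVskip i j k))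
        (c (Fin.cons (SVbrk (a i) (a j)).1 fun k => a (SVskip i j k))))

/-- The differential `d_q : C̃^q → C̃^{q+1}` (trivial coefficients). -/
noncomputable def SVd : {q : ℕ} → SVRaw q → SVRaw (q + 1)
  | 0, _ => 0
  | (q + 1), c => fun a =>
      ∑ i : Fin (q + 2), ∑ j : Fin (q + 2),
        if (i : ℕ) < (j : ℕ) then SVdTerm c a i j else 0

lemma SVdTerm_add {q : ℕ} (c c' : SVRaw (q + 1)) (a : Fin (q + 2) → SVGen)
    (i j : Fin (q + 2)) :
    SVdTerm (c + c') a i j = SVdTerm c a i j + SVdTerm c' a i j := by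
  simp [SVdTerm, mul_add, smul_add]

lemma SVdTerm_smul {q : ℕ} (r : ℂ) (c : SVRaw (q + 1)) (a : Fin (q + 2) → SVGen)
    (i j : Fin (q + 2)) :
    SVdTerm (r • c) a i j = r • SVdTerm c a i j := by
  simp only [SVdTerm, Pi.smul_apply, map_smul, mul_smul_comm]
  rw [smul_comm]

/-- The differential as a `ℂ`-linear map. -/
noncomputable def SVdLin (q : ℕ) : SVRaw q →ₗ[ℂ] SVRaw (q + 1) where
  toFun := SVd
  map_add' c c' := by
    cases q with
    | zero => simp [SVd]
    | succ q =>
      funext a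
      simp only [SVd, Pi.add_apply]
      rw [← Finset.sum_add_distrib]
      refine Finset.sum_congr rfl fun i _ => ?_
      rw [← Finset.sum_add_distrib]
      refine Finset.sum_congr rfl fun j _ => ?_
      by_cases h : (i : ℕ) < (j : ℕ)
      · simp [h, SVdTerm_add]
      · simp [h]
  map_smul' r c := by
    cases q with
    | zero => simp [SVd]
    | succ q =>
      funext a
      simp only [SVd, RingHom.id_apply, Pi.smul_apply, Finset.smul_sum]
      refine Finset.sum_congr rfl fun i _ => ?_
      refine Finset.sum_congr rfl fun j _ => ?_
      by_cases h : (i : ℕ) < (j : ℕ)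
      · simp [h, SVdTerm_smul]
      · simp [h]

/-- The space `D̃^q(SV,ℂ)` of `q`-cocycles: skew-symmetric cochains with `dγ = 0`. -/
noncomputable def SVcocycles (q : ℕ) : Submodule ℂ (SVRaw q) :=
  SVCochain q ⊓ LinearMap.ker (SVdLin q)

/-- The space `B̃^q(SV,ℂ)` of `q`-coboundaries: differentials of `(q-1)`-cochains
(`0` for `q = 0`). -/
noncomputable def SVcoboundaries : (q : ℕ) → Submodule ℂ (SVRaw q)
  | 0 => ⊥
  | (q + 1) => Submodule.map (SVdLin q) (SVCochain q)

/-- The basic cohomology `H̃^q(SV,ℂ)` = cocycles / coboundaries. -/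
noncomputable def SVbasicH (q : ℕ) :=
  SVcocycles q ⧸ Submodule.comap (SVcocycles q).subtype (SVcoboundaries q)


noncomputable instance (q : ℕ) : AddCommGroup (SVbasicH q) := by
  unfold SVbasicH; infer_instance
noncomputable instance (q : ℕ) : Module ℂ (SVbasicH q) := by
  unfold SVbasicH; infer_instance

/-- The action of `∂` on `q`-cochains with coefficients in `ℂ_a`:
`(∂γ)_{λ₁,…,λ_q} = (a + λ₁ + ⋯ + λ_q)·γ_{λ₁,…,λ_q}`.  (The trivial module `ℂ`
is the case `a = 0`.) -/
noncomputable def SVpartial (a : ℂ) (q : ℕ) : SVRaw q →ₗ[ℂ] SVRaw q where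
  toFun c := fun t => (C a + ∑ i, X i) * c t
  map_add' c c' := by funext t; simp [mul_add]
  map_smul' r c := by funext t; simp [mul_smul_comm]

/-- The subspace `∂C̃^q ⊆ C̃^q` (with coefficients in `ℂ_a`). -/
noncomputable def SVpartialSub (a : ℂ) (q : ℕ) : Submodule ℂ (SVRaw q) :=
  Submodule.map (SVpartial a q) (SVCochain q)

/-- `q`-cochains representing reduced `q`-cocycles: cochains `γ` with
`dγ ∈ ∂C̃^{q+1}` (these are exactly the representatives of `ker d̄`
in the quotient complex `C̃^•/∂C̃^•`). -/
noncomputable def SVredCocycles (a : ℂ) (q : ℕ) : Submodule ℂ (SVRaw q) :=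
  SVCochain q ⊓ Submodule.comap (SVdLin q) (SVpartialSub a (q + 1))

/-- `q`-cochains representing reduced `q`-coboundaries: `∂C̃^q + dC̃^{q-1}`
(these are exactly the representatives of `im d̄` in the quotient complex). -/
noncomputable def SVredCoboundaries (a : ℂ) : (q : ℕ) → Submodule ℂ (SVRaw q)
  | 0 => SVpartialSub a 0
  | (q + 1) => SVpartialSub a (q + 1) ⊔ Submodule.map (SVdLin q) (SVCochain q)

/-- The reduced cohomology `H^q(SV,ℂ_a)`, realized (via the third isomorphism
theorem) as `{γ ∈ C̃^q : dγ ∈ ∂C̃^{q+1}} / (∂C̃^q + dC̃^{q-1})`. -/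
noncomputable def SVredH (a : ℂ) (q : ℕ) :=
  SVredCocycles a q ⧸ Submodule.comap (SVredCocycles a q).subtype (SVredCoboundaries a q)


noncomputable instance (a : ℂ) (q : ℕ) : AddCommGroup (SVredH a q) := by
  unfold SVredH; infer_instance
noncomputable instance (a : ℂ) (q : ℕ) : Module ℂ (SVredH a q) := by
  unfold SVredH; infer_instance

/-- The cocycles of the subcomplex `∂C̃^•` (trivial coefficients `ℂ`). -/
noncomputable def SVsubCocycles (q : ℕ) : Submodule ℂ (SVRaw q) :=
  SVpartialSub 0 q ⊓ LinearMap.ker (SVdLin q)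

/-- The coboundaries of the subcomplex `∂C̃^•` (trivial coefficients `ℂ`). -/
noncomputable def SVsubCoboundaries : (q : ℕ) → Submodule ℂ (SVRaw q)
  | 0 => ⊥
  | (q + 1) => Submodule.map (SVdLin q) (SVpartialSub 0 q)

/-- The cohomology `H^q(∂C̃^•)` of the subcomplex `∂C̃^•` (trivial coefficients). -/
noncomputable def SVsubH (q : ℕ) :=
  SVsubCocycles q ⧸ Submodule.comap (SVsubCocycles q).subtype (SVsubCoboundaries q)


noncomputable instance (q : ℕ) : AddCommGroup (SVsubH q) := by
  unfold SVsubH; infer_instance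
noncomputable instance (q : ℕ) : Module ℂ (SVsubH q) := by
  unfold SVsubH; infer_instance

/-- The operator `τ`:
`(τγ)_{λ₁,…,λ_{q-1}}(a₁,…,a_{q-1}) = (-1)^{q-1} ∂/∂λ γ_{λ₁,…,λ_{q-1},λ}(a₁,…,a_{q-1},L)|_{λ=0}`. -/
noncomputable def SVtau {q : ℕ} (c : SVRaw (q + 1)) : SVRaw q := fun a =>
  ((-1 : ℂ) ^ q) •
    aeval (Fin.snoc (fun i : Fin q => X i) 0)
      (pderiv (Fin.last q) (c (Fin.snoc a SVGen.L)))

/-- The operator `τ₂`: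
`(τ₂γ)_{λ₁,…,λ_{q-1}}(a₁,…,a_{q-1}) = (-1)^{q-1} γ_{λ₁,…,λ_{q-1},λ}(a₁,…,a_{q-1},L)|_{λ=0}`. -/
noncomputable def SVtau2 {q : ℕ} (c : SVRaw (q + 1)) : SVRaw q := fun a =>
  ((-1 : ℂ) ^ q) • aeval (Fin.snoc (fun i : Fin q => X i) 0) (c (Fin.snoc a SVGen.L))

/-- The tuple with `k` copies of `L`, then `l` copies of `Y`, then copies of `M`. -/
def SVtuple (q k l : ℕ) : Fin q → SVGen := fun i =>
  if (i : ℕ) < k then SVGen.L else if (i : ℕ) < k + l then SVGen.Y else SVGen.M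

/-- `∏_{i<j ∈ s} (λᵢ - λⱼ)`. -/
noncomputable def SVvandermonde (q : ℕ) (s : Finset (Fin q)) : MvPolynomial (Fin q) ℂ :=
  ∏ p ∈ (s ×ˢ s).filter fun p => p.1 < p.2, (X p.1 - X p.2)

section ModeValues

variable {ι : Type*} [Fintype ι]

/-- The value at `0` of the iterated partial derivative of multi-order `n`. -/
noncomputable def modeValue (n : ι → ℕ) : MvPolynomial ι ℂ →ₗ[ℂ] ℂ :=
  (∏ i, ((n i).factorial : ℂ)) • lcoeff ℂ (Finsupp.equivFunOnFinite.symm n)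

lemma modeValue_apply (n : ι → ℕ) (p : MvPolynomial ι ℂ) :
    modeValue n p =
      (∏ i, ((n i).factorial : ℂ)) * coeff (Finsupp.equivFunOnFinite.symm n) p := by
  simp [modeValue]

lemma prod_factorial_ne_zero (n : ι → ℕ) : (∏ i, ((n i).factorial : ℂ)) ≠ 0 :=
  Finset.prod_ne_zero_iff.2 fun i _ => Nat.cast_ne_zero.2 (Nat.factorial_ne_zero _)

lemma modeValue_ext {p p' : MvPolynomial ι ℂ} (h : ∀ n, modeValue n p = modeValue n p') :
    p = p' := by
  ext m
  have := h m
  rw [modeValue_apply, modeValue_apply] at this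
  simpa using mul_left_cancel₀ (prod_factorial_ne_zero _) this

lemma modeValue_C [DecidableEq ι] (n : ι → ℕ) (a : ℂ) :
    modeValue n (C a) = if n = 0 then a else 0 := by
  rw [modeValue_apply, coeff_C]
  by_cases h : n = 0
  · subst h
    have : (0 : ι →₀ ℕ) = Finsupp.equivFunOnFinite.symm 0 := by ext; simp
    simp [← this]
  · have : (0 : ι →₀ ℕ) ≠ Finsupp.equivFunOnFinite.symm n := fun h' =>
      h (by ext i; simpa using (DFunLike.congr_fun h' i).symm)
    simp [this, h]

lemma modeValue_X_mul [DecidableEq ι] (n : ι → ℕ) (s : ι) (p : MvPolynomial ι ℂ) :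
    modeValue n (X s * p) = n s * modeValue (Function.update n s (n s - 1)) p := by
  rw [modeValue_apply, modeValue_apply, coeff_X_mul']
  rcases Nat.eq_zero_or_pos (n s) with h | h
  · simp [h]
  · have h1 : s ∈ (Finsupp.equivFunOnFinite.symm n).support := by simp; omega
    have h2 : Finsupp.equivFunOnFinite.symm n - Finsupp.single s 1 =
        Finsupp.equivFunOnFinite.symm (Function.update n s (n s - 1)) := by
      ext i
      rcases eq_or_ne i s with rfl | hi
      · simp
      · simp [hi]
    rw [if_pos h1, h2, ← mul_assoc]
    congr 1
    rw [← Finset.mul_prod_erase _ _ (Finset.mem_univ s),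
      ← Finset.mul_prod_erase _ (fun i => ((Function.update n s (n s - 1) i).factorial : ℂ))
        (Finset.mem_univ s), ← mul_assoc]
    congr 1
    · simp only [Function.update_self]
      exact_mod_cast (Nat.mul_factorial_pred h.ne').symm
    · refine Finset.prod_congr rfl fun i hi => ?_
      rw [Function.update_of_ne (Finset.ne_of_mem_erase hi)]

lemma modeValue_rename (n : ι → ℕ) (σ : Equiv.Perm ι) (p : MvPolynomial ι ℂ) :
    modeValue n (rename σ p) = modeValue (n ∘ σ) p := by
  rw [modeValue_apply, modeValue_apply]
  have h : Finsupp.equivFunOnFinite.symm n =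
      (Finsupp.equivFunOnFinite.symm (n ∘ σ)).mapDomain σ := by
    ext i
    conv_rhs => rw [← σ.apply_symm_apply i, Finsupp.mapDomain_apply σ.injective]
    simp
  rw [h, coeff_rename_mapDomain σ σ.injective]
  congr 1
  exact (Equiv.prod_comp σ fun i => ((n i).factorial : ℂ)).symm

end ModeValues

section Skip

variable {q : ℕ}

/-- The index `i` viewed in `Fin (q + 1)`, truncated at the last element. -/
def clip (i : Fin (q + 2)) : Fin (q + 1) :=
  ⟨min (i : ℕ) q, Nat.lt_succ_of_le (Nat.min_le_right _ _)⟩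

lemma SVskip_eq (i j : Fin (q + 2)) (k : Fin q) :
    SVskip i j k = j.succAbove ((clip i).succAbove k) := rfl

lemma val_clip {i j : Fin (q + 2)} (h : i < j) : (clip i : ℕ) = i := by
  have : (i : ℕ) < j := h
  have := j.2
  simp only [clip]; omega

lemma succAbove_clip {i j : Fin (q + 2)} (h : i < j) : j.succAbove (clip i) = i := by
  have e : (clip i).castSucc = i := Fin.ext (val_clip h)
  rw [Fin.succAbove_of_castSucc_lt _ _ (by rwa [e]), e]

lemma SVskip_injective (i j : Fin (q + 2)) : Function.Injective (SVskip i j) := fun _ _ h =>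
  Fin.succAbove_right_injective (Fin.succAbove_right_injective h)

lemma SVskip_ne_right (i j : Fin (q + 2)) (k : Fin q) : SVskip i j k ≠ j :=
  Fin.succAbove_ne _ _

lemma SVskip_ne_left {i j : Fin (q + 2)} (h : i < j) (k : Fin q) : SVskip i j k ≠ i := by
  intro e
  exact Fin.succAbove_ne _ _ (Fin.succAbove_right_injective (e.trans (succAbove_clip h).symm))

lemma SVskip_cover {i j : Fin (q + 2)} (h : i < j) (l : Fin (q + 2)) :
    l = i ∨ l = j ∨ ∃ k, l = SVskip i j k := by
  rcases Fin.eq_self_or_eq_succAbove j l with hl | ⟨m, rfl⟩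
  · exact Or.inr (Or.inl hl)
  · rcases Fin.eq_self_or_eq_succAbove (clip i) m with rfl | ⟨k, rfl⟩
    · exact Or.inl (succAbove_clip h)
    · exact Or.inr (Or.inr ⟨k, rfl⟩)

lemma SVskip_castSucc_castSucc {i j : Fin (q + 2)} (h : i < j) (k : Fin q) :
    SVskip i.castSucc j.castSucc k.castSucc = (SVskip i j k).castSucc := by
  have e : clip i.castSucc = (clip i).castSucc :=
    Fin.ext (by rw [val_clip (Fin.castSucc_lt_castSucc_iff.2 h)]; simp [val_clip h])
  rw [SVskip_eq, SVskip_eq, e, Fin.castSucc_succAbove_castSucc, Fin.castSucc_succAbove_castSucc]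

lemma castSucc_succAbove_last (i : Fin (q + 1)) :
    i.castSucc.succAbove (Fin.last q) = Fin.last (q + 1) := by
  rw [Fin.succAbove_of_le_castSucc _ _ (Fin.castSucc_le_castSucc_iff.2 (Fin.le_last i)),
    Fin.succ_last]

lemma SVskip_castSucc_last {i j : Fin (q + 2)} (h : i < j) :
    SVskip i.castSucc j.castSucc (Fin.last q) = Fin.last (q + 2) := by
  have e : clip i.castSucc = (clip i).castSucc :=
    Fin.ext (by rw [val_clip (Fin.castSucc_lt_castSucc_iff.2 h)]; simp [val_clip h])
  rw [SVskip_eq, e, castSucc_succAbove_last, castSucc_succAbove_last]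

lemma SVskip_last (i : Fin (q + 1)) (k : Fin q) :
    SVskip i.castSucc (Fin.last (q + 1)) k = (i.succAbove k).castSucc := by
  have e : clip i.castSucc = i := Fin.ext (val_clip (Fin.castSucc_lt_last i))
  rw [SVskip_eq, e, Fin.succAbove_last]

/-- The permutation listing `j`, then `i`, then the remaining indices in increasing order. -/
def frontPerm (i j : Fin (q + 2)) : Equiv.Perm (Fin (q + 2)) :=
  j.cycleRange.symm * Equiv.Perm.decomposeFin.symm (0, (clip i).cycleRange.symm)

lemma frontPerm_zero (i j : Fin (q + 2)) : frontPerm i j 0 = j := by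
  simp [frontPerm]

lemma frontPerm_one {i j : Fin (q + 2)} (h : i < j) : frontPerm i j 1 = i := by
  have : (1 : Fin (q + 2)) = Fin.succ 0 := rfl
  rw [this, frontPerm, Equiv.Perm.mul_apply, Equiv.Perm.decomposeFin_symm_apply_succ]
  simp [succAbove_clip h]

lemma frontPerm_succ_succ (i j : Fin (q + 2)) (k : Fin q) :
    frontPerm i j k.succ.succ = SVskip i j k := by
  rw [frontPerm, Equiv.Perm.mul_apply, Equiv.Perm.decomposeFin_symm_apply_succ]
  simp [SVskip_eq]

lemma sign_frontPerm {i j : Fin (q + 2)} (h : i < j) :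
    ((Equiv.Perm.sign (frontPerm i j) : ℤ) : ℂ) = (-1) ^ ((i : ℕ) + j) := by
  simp [frontPerm, Fin.sign_cycleRange, Equiv.Perm.decomposeFin.symm_sign, val_clip h, pow_add,
    mul_comm]

lemma modeValue_aeval_cons {i j : Fin (q + 2)} (h : i < j) (p : MvPolynomial (Fin (q + 1)) ℂ)
    (n : Fin (q + 2) → ℕ) :
    modeValue n (aeval (Fin.cons (X i + X j) fun k => X (SVskip i j k) :
        Fin (q + 1) → MvPolynomial (Fin (q + 2)) ℂ) p) =
      modeValue (Fin.cons (n i + n j) fun k => n (SVskip i j k)) p := by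
  induction p using MvPolynomial.induction_on generalizing n with
  | C a =>
    rw [aeval_C, algebraMap_eq, modeValue_C, modeValue_C]
    congr 1
    refine propext ⟨?_, fun hn => funext fun l => ?_⟩
    · rintro rfl
      ext k
      refine Fin.cases ?_ (fun k => ?_) k <;> simp
    · have h0 := congrFun hn 0
      simp only [Fin.cons_zero, Pi.zero_apply] at h0
      rcases SVskip_cover h l with rfl | rfl | ⟨k, rfl⟩
      · simp; omega
      · simp; omega
      · simpa using congrFun hn k.succ
  | add p p' hp hp' => simp only [map_add, hp, hp']
  | mul_X p s hp =>
    rw [map_mul, aeval_X, mul_comm, mul_comm p, modeValue_X_mul]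
    refine Fin.cases ?_ (fun k => ?_) s
    · rw [Fin.cons_zero, add_mul, map_add, modeValue_X_mul, modeValue_X_mul, hp, hp]
      simp only [Fin.cons_zero, Fin.update_cons_zero, Function.update_self,
        Function.update_of_ne h.ne, Function.update_of_ne h.ne',
        Function.update_of_ne (SVskip_ne_left h _), Function.update_of_ne (SVskip_ne_right i j _)]
      push_cast
      rw [add_mul]
      congr 1
      · rcases Nat.eq_zero_or_pos (n i) with h0 | h0
        · simp [h0]
        · rw [show n i - 1 + n j = n i + n j - 1 by omega]
      · rcases Nat.eq_zero_or_pos (n j) with h0 | h0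
        · simp [h0]
        · rw [show n i + (n j - 1) = n i + n j - 1 by omega]
    · rw [Fin.cons_succ, modeValue_X_mul, hp, Fin.cons_succ]
      refine congrArg (_ * modeValue · p) (funext fun l => ?_)
      refine Fin.cases ?_ (fun l => ?_) l
      · simp [Function.update_of_ne (SVskip_ne_left h k).symm,
          Function.update_of_ne (Fin.succ_ne_zero k).symm,
          Function.update_of_ne (SVskip_ne_right i j k).symm]
      · rcases eq_or_ne l k with rfl | hl
        · simp
        · rw [Fin.cons_succ, Function.update_of_ne ((SVskip_injective i j).ne hl),
            Function.update_of_ne (by simpa using hl), Fin.cons_succ]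

end Skip

section Modes

/-- The generator appearing in the bracket of two generators. -/
def genBrk (a b : SVGen) : SVGen := match a, b with
  | L, L => L
  | L, Y => Y
  | Y, L => Y
  | _, _ => M

lemma SVbrk_fst (a b : SVGen) : (SVbrk a b).1 = genBrk a b := by
  cases a <;> cases b <;> rfl

/-- The mode `(a, n)` stands for the `n`-th annihilation mode of the generator `a`;
brackets of modes are multiples of modes. -/
def modeBrk (x y : SVGen × ℕ) : SVGen × ℕ := (genBrk x.1 y.1, x.2 + y.2 - 1)

/-- Twice the structure constant of the bracket of two modes. -/
def modeCoef (x y : SVGen × ℕ) : ℤ := match x.1, y.1 with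
  | L, L => 2 * x.2 - 2 * y.2
  | L, Y => x.2 - 2 * y.2
  | Y, L => 2 * x.2 - y.2
  | Y, Y => 2 * x.2 - 2 * y.2
  | L, M => -2 * y.2
  | M, L => 2 * x.2
  | _, _ => 0

/-- Twice the conformal weight of a mode. -/
def modeWt (x : SVGen × ℕ) : ℤ := match x.1 with
  | L => 2 * x.2 - 2
  | Y => 2 * x.2 - 1
  | M => 2 * x.2

lemma modeBrk_comm (x y : SVGen × ℕ) : modeBrk x y = modeBrk y x := by
  obtain ⟨a, m⟩ := x
  obtain ⟨b, n⟩ := y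
  refine Prod.ext ?_ (by simp only [modeBrk]; omega)
  cases a <;> cases b <;> rfl

lemma modeCoef_antisymm (x y : SVGen × ℕ) : modeCoef x y = -modeCoef y x := by
  obtain ⟨a, m⟩ := x
  obtain ⟨b, n⟩ := y
  cases a <;> cases b <;> simp [modeCoef]

lemma modeCoef_L_one (x : SVGen × ℕ) : modeCoef x (L, 1) = modeWt x := by
  obtain ⟨a, m⟩ := x
  cases a <;> simp [modeCoef, modeWt]

lemma modeBrk_L_one (x : SVGen × ℕ) : modeBrk x (L, 1) = x := by
  obtain ⟨a, m⟩ := x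
  cases a <;> simp [modeBrk, genBrk]

lemma modeWt_modeBrk {x y : SVGen × ℕ} (h : modeCoef x y ≠ 0) :
    modeWt (modeBrk x y) = modeWt x + modeWt y := by
  obtain ⟨a, m⟩ := x
  obtain ⟨b, n⟩ := y
  cases a <;> cases b <;> simp [modeCoef, modeBrk, modeWt, genBrk] at h ⊢ <;> omega

variable {q : ℕ}

/-- The weight of a tuple of modes. -/
def tupleWt (x : Fin q → SVGen × ℕ) : ℤ := ∑ i, modeWt (x i)

/-- The value of a cochain on a tuple of modes. -/
noncomputable def onModes (c : SVRaw q) (x : Fin q → SVGen × ℕ) : ℂ :=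
  modeValue (fun i => (x i).2) (c fun i => (x i).1)

lemma onModes_ext {c c' : SVRaw q} (h : ∀ x, onModes c x = onModes c' x) : c = c' :=
  funext fun a => modeValue_ext fun n => h fun i => (a i, n i)

/-- Skew-symmetric functions of a tuple. -/
def IsSkew {G : Type*} (f : (Fin q → G) → ℂ) : Prop :=
  ∀ (σ : Equiv.Perm (Fin q)) (x : Fin q → G),
    f (x ∘ σ) = ((Equiv.Perm.sign σ : ℤ) : ℂ) * f x

lemma mem_SVCochain_iff (c : SVRaw q) : c ∈ SVCochain q ↔ IsSkew (onModes c) := by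
  constructor
  · intro h σ x
    have := congrArg (modeValue fun i => (x i).2) (h σ fun i => (x i).1)
    rwa [modeValue_rename, map_smul, smul_eq_mul] at this
  · intro h σ a
    refine modeValue_ext fun n => ?_
    rw [modeValue_rename, map_smul, smul_eq_mul]
    exact h σ fun i => (a i, n i)

lemma IsSkew.eq_zero {G : Type*} {f : (Fin q → G) → ℂ} (hf : IsSkew f) {x : Fin q → G}
    (hx : ¬ Function.Injective x) : f x = 0 := by
  simp only [Function.Injective, not_forall] at hx
  obtain ⟨i, j, hij, hne⟩ := hx
  have h := hf (Equiv.swap i j) x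
  have e : x ∘ Equiv.swap i j = x := by
    ext1 k
    rcases eq_or_ne k i with rfl | hi
    · simp [hij]
    · rcases eq_or_ne k j with rfl | hj
      · simp [hij]
      · simp [Equiv.swap_apply_of_ne_of_ne hi hj]
  rw [e, Equiv.Perm.sign_swap hne] at h
  push_cast at h
  linear_combination h / 2

lemma tupleWt_comp_perm (σ : Equiv.Perm (Fin q)) (x : Fin q → SVGen × ℕ) :
    tupleWt (x ∘ σ) = tupleWt x :=
  Equiv.sum_comp σ fun i => modeWt (x i)

/-- The tuple in which the entries `i < j` are replaced by their bracket, put in front. -/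
def contract (x : Fin (q + 2) → SVGen × ℕ) (i j : Fin (q + 2)) : Fin (q + 1) → SVGen × ℕ :=
  Fin.cons (modeBrk (x i) (x j)) fun k => x (SVskip i j k)

/-- The `(i, j)`-summand of the differential, on modes. -/
noncomputable def modeTerm (f : (Fin (q + 1) → SVGen × ℕ) → ℂ) (x : Fin (q + 2) → SVGen × ℕ)
    (i j : Fin (q + 2)) : ℂ :=
  (-1) ^ ((i : ℕ) + j) * (modeCoef (x i) (x j) / 2) * f (contract x i j)

/-- The differential on modes. -/
noncomputable def modeD (f : (Fin (q + 1) → SVGen × ℕ) → ℂ) (x : Fin (q + 2) → SVGen × ℕ) : ℂ :=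
  ∑ i, ∑ j, if i < j then modeTerm f x i j else 0

lemma onModes_SVdTerm (c : SVRaw (q + 1)) (x : Fin (q + 2) → SVGen × ℕ) {i j : Fin (q + 2)}
    (h : i < j) :
    modeValue (fun i => (x i).2) (SVdTerm c (fun i => (x i).1) i j) =
      modeTerm (onModes c) x i j := by
  set n : Fin (q + 2) → ℕ := fun i => (x i).2 with hn
  set a : Fin (q + 2) → SVGen := fun i => (x i).1 with ha
  set P := c (Fin.cons (SVbrk (a i) (a j)).1 fun k => a (SVskip i j k)) with hP
  set Q := aeval (Fin.cons (X i + X j) fun k => X (SVskip i j k) :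
    Fin (q + 1) → MvPolynomial (Fin (q + 2)) ℂ) P with hQ
  set N : ℕ → Fin (q + 1) → ℕ := fun m => Fin.cons m fun k => n (SVskip i j k) with hN
  have hi : (n i : ℂ) * modeValue (Function.update n i (n i - 1)) Q =
      n i * modeValue (N (n i + n j - 1)) P := by
    rcases Nat.eq_zero_or_pos (n i) with h0 | h0
    · simp [h0]
    · rw [hQ, modeValue_aeval_cons h]
      simp only [Function.update_self, Function.update_of_ne h.ne',
        Function.update_of_ne (SVskip_ne_left h _)]
      rw [show n i - 1 + n j = n i + n j - 1 by omega]
  have hj : (n j : ℂ) * modeValue (Function.update n j (n j - 1)) Q =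
      n j * modeValue (N (n i + n j - 1)) P := by
    rcases Nat.eq_zero_or_pos (n j) with h0 | h0
    · simp [h0]
    · rw [hQ, modeValue_aeval_cons h]
      simp only [Function.update_self, Function.update_of_ne h.ne,
        Function.update_of_ne (SVskip_ne_right i j _)]
      rw [show n i + (n j - 1) = n i + n j - 1 by omega]
  have hf : onModes c (contract x i j) = modeValue (N (n i + n j - 1)) P := by
    have e1 : (fun k => (contract x i j k).1) =
        Fin.cons (SVbrk (a i) (a j)).1 fun k => a (SVskip i j k) := by
      ext1 k
      refine Fin.cases ?_ (fun k => ?_) k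
      · simp [contract, modeBrk, SVbrk_fst, ha]
      · simp [contract, ha]
    have e2 : (fun k => (contract x i j k).2) = N (n i + n j - 1) := by
      ext1 k
      refine Fin.cases ?_ (fun k => ?_) k
      · simp [contract, modeBrk, hn, hN]
      · simp [contract, hn, hN]
    rw [onModes, e1, e2]
  have hc : (modeCoef (x i) (x j) : ℂ) / 2 =
      ((SVbrk (a i) (a j)).2.2 - (SVbrk (a i) (a j)).2.1) * n i -
        (SVbrk (a i) (a j)).2.1 * n j := by
    simp only [modeCoef, ha, hn]
    cases (x i).1 <;> cases (x j).1 <;> simp [SVbrk] <;> ring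
  have hexp : SVdTerm c a i j = ((-1 : ℂ) ^ ((i : ℕ) + j)) •
      (((SVbrk (a i) (a j)).2.2 - (SVbrk (a i) (a j)).2.1) • (X i * Q) -
        (SVbrk (a i) (a j)).2.1 • (X j * Q)) := by
    rw [SVdTerm]
    congr 1
    simp only [smul_eq_C_mul, C_sub]
    ring
  rw [hexp, modeTerm, hf, hc]
  simp only [map_smul, map_sub, modeValue_X_mul, hi, hj, smul_eq_mul]
  ring

lemma onModes_SVd (c : SVRaw (q + 1)) : onModes (SVd c) = modeD (onModes c) := by
  ext x
  simp only [onModes, SVd, map_sum, modeD]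
  refine Finset.sum_congr rfl fun i _ => Finset.sum_congr rfl fun j _ => ?_
  by_cases h : i < j
  · rw [if_pos h, if_pos (show (i : ℕ) < j from h)]
    exact onModes_SVdTerm c x h
  · rw [if_neg h, if_neg (show ¬ (i : ℕ) < j from h), map_zero]

end Modes

section Differential

variable {q : ℕ}

/-- The contraction of the first two entries of a tuple, in reverse order. -/
noncomputable def frontTerm (f : (Fin (q + 1) → SVGen × ℕ) → ℂ) (x : Fin (q + 2) → SVGen × ℕ) :
    ℂ :=
  (modeCoef (x 1) (x 0) / 2) * f (Fin.cons (modeBrk (x 1) (x 0)) fun k => x k.succ.succ)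

lemma modeTerm_eq_frontTerm (f : (Fin (q + 1) → SVGen × ℕ) → ℂ) (x : Fin (q + 2) → SVGen × ℕ)
    {i j : Fin (q + 2)} (h : i < j) :
    modeTerm f x i j =
      ((Equiv.Perm.sign (frontPerm i j) : ℤ) : ℂ) * frontTerm f (x ∘ frontPerm i j) := by
  simp only [modeTerm, frontTerm, sign_frontPerm h, Function.comp_apply, frontPerm_zero,
    frontPerm_one h, frontPerm_succ_succ, contract, mul_assoc]

lemma exists_perm_of_fixes_zero_one {κ : Equiv.Perm (Fin (q + 2))} (h0 : κ 0 = 0) (h1 : κ 1 = 1) :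
    ∃ τ : Equiv.Perm (Fin (q + 1)), Equiv.Perm.sign τ = Equiv.Perm.sign κ ∧ τ 0 = 0 ∧
      ∀ k : Fin q, (τ k.succ).succ = κ k.succ.succ := by
  obtain ⟨⟨p, τ⟩, rfl⟩ := Equiv.Perm.decomposeFin.symm.surjective κ
  have hp : p = 0 := by simpa using h0
  subst hp
  have e : ∀ k, Equiv.Perm.decomposeFin.symm (0, τ) k.succ = (τ k).succ := fun k => by simp
  refine ⟨τ, by simp [Equiv.Perm.decomposeFin.symm_sign], ?_, fun k => (e _).symm⟩
  have h := (e 0).symm.trans h1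
  exact Fin.succ_injective _ h

lemma frontTerm_comp_of_fixes {f : (Fin (q + 1) → SVGen × ℕ) → ℂ} (hf : IsSkew f)
    (x : Fin (q + 2) → SVGen × ℕ) {κ : Equiv.Perm (Fin (q + 2))} (h0 : κ 0 = 0) (h1 : κ 1 = 1) :
    frontTerm f (x ∘ κ) = ((Equiv.Perm.sign κ : ℤ) : ℂ) * frontTerm f x := by
  obtain ⟨τ, hs, hτ, hk⟩ := exists_perm_of_fixes_zero_one h0 h1
  have e : (Fin.cons (modeBrk (x 1) (x 0)) fun k => x (κ k.succ.succ) :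
      Fin (q + 1) → SVGen × ℕ) =
      (Fin.cons (modeBrk (x 1) (x 0)) fun k => x k.succ.succ : Fin (q + 1) → SVGen × ℕ) ∘ τ := by
    ext1 k
    refine Fin.cases ?_ (fun k => ?_) k
    · simp [hτ]
    · have hne : τ k.succ ≠ 0 := fun h =>
        Fin.succ_ne_zero k (τ.injective (h.trans hτ.symm))
      obtain ⟨l, hl⟩ := Fin.exists_succ_eq.2 hne
      simp [← hk, ← hl]
  simp only [frontTerm, Function.comp_apply, h0, h1]
  rw [e, hf τ, hs]
  ring

lemma frontTerm_comp_swap (f : (Fin (q + 1) → SVGen × ℕ) → ℂ) (x : Fin (q + 2) → SVGen × ℕ) :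
    frontTerm f (x ∘ Equiv.swap 0 1) = -frontTerm f x := by
  have e : ∀ k : Fin q, Equiv.swap (0 : Fin (q + 2)) 1 k.succ.succ = k.succ.succ := fun k =>
    Equiv.swap_apply_of_ne_of_ne (Fin.succ_ne_zero _)
      fun h => Fin.succ_ne_zero k (Fin.succ_injective _ h)
  simp only [frontTerm, Function.comp_apply, Equiv.swap_apply_left, Equiv.swap_apply_right, e]
  rw [modeCoef_antisymm, modeBrk_comm]
  push_cast
  ring

lemma sign_mul_frontTerm_congr {f : (Fin (q + 1) → SVGen × ℕ) → ℂ} (hf : IsSkew f)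
    (x : Fin (q + 2) → SVGen × ℕ) {ρ ρ' : Equiv.Perm (Fin (q + 2))} (h0 : ρ 0 = ρ' 0)
    (h1 : ρ 1 = ρ' 1) :
    ((Equiv.Perm.sign ρ : ℤ) : ℂ) * frontTerm f (x ∘ ρ) =
      ((Equiv.Perm.sign ρ' : ℤ) : ℂ) * frontTerm f (x ∘ ρ') := by
  have e : x ∘ ρ' = (x ∘ ρ) ∘ (ρ⁻¹ * ρ' : Equiv.Perm _) := by ext1 k; simp
  have hρ : ((Equiv.Perm.sign ρ : ℤ) : ℂ) * (Equiv.Perm.sign ρ : ℤ) = 1 := by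
    exact_mod_cast Int.units_coe_mul_self _
  have hρ' : ((Equiv.Perm.sign ρ' : ℤ) : ℂ) * (Equiv.Perm.sign ρ' : ℤ) = 1 := by
    exact_mod_cast Int.units_coe_mul_self _
  rw [e, frontTerm_comp_of_fixes hf (x ∘ ρ) (by simp [← h0]) (by simp [← h1])]
  simp only [Equiv.Perm.sign_mul, Equiv.Perm.sign_inv, Units.val_mul, Int.cast_mul]
  linear_combination -((Equiv.Perm.sign ρ : ℤ) : ℂ) * frontTerm f (x ∘ ρ) * hρ'

/-- The summand of the differential, extended to a symmetric function of the two indices. -/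
noncomputable def symmTerm (f : (Fin (q + 1) → SVGen × ℕ) → ℂ) (x : Fin (q + 2) → SVGen × ℕ)
    (i j : Fin (q + 2)) : ℂ :=
  (if i < j then modeTerm f x i j else 0) + (if j < i then modeTerm f x j i else 0)

lemma symmTerm_eq {f : (Fin (q + 1) → SVGen × ℕ) → ℂ} (hf : IsSkew f)
    (x : Fin (q + 2) → SVGen × ℕ) {i j : Fin (q + 2)} {ρ : Equiv.Perm (Fin (q + 2))}
    (h0 : ρ 0 = j) (h1 : ρ 1 = i) :
    symmTerm f x i j = ((Equiv.Perm.sign ρ : ℤ) : ℂ) * frontTerm f (x ∘ ρ) := by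
  have hne : i ≠ j := by
    rw [← h0, ← h1]
    exact fun h => Fin.zero_ne_one (ρ.injective h).symm
  rcases lt_or_gt_of_ne hne with h | h
  · rw [symmTerm, if_pos h, if_neg h.not_gt, add_zero, modeTerm_eq_frontTerm f x h]
    exact sign_mul_frontTerm_congr hf x (by rw [frontPerm_zero, h0])
      (by rw [frontPerm_one h, h1])
  · rw [symmTerm, if_pos h, if_neg h.not_gt, zero_add, modeTerm_eq_frontTerm f x h,
      sign_mul_frontTerm_congr hf x (ρ' := ρ * Equiv.swap 0 1)
        (by simp [frontPerm_zero, h1]) (by simp [frontPerm_one h, h0])]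
    have e : x ∘ (ρ * Equiv.swap 0 1 : Equiv.Perm _) = (x ∘ ρ) ∘ Equiv.swap 0 1 := rfl
    rw [e, frontTerm_comp_swap, Equiv.Perm.sign_mul, Equiv.Perm.sign_swap Fin.zero_ne_one]
    push_cast
    ring

lemma exists_perm_zero_one {i j : Fin (q + 2)} (h : i ≠ j) :
    ∃ ρ : Equiv.Perm (Fin (q + 2)), ρ 0 = j ∧ ρ 1 = i := by
  rcases lt_or_gt_of_ne h with h | h
  · exact ⟨frontPerm i j, frontPerm_zero _ _, frontPerm_one h⟩
  · exact ⟨frontPerm j i * Equiv.swap 0 1, by simp [frontPerm_one h], by simp [frontPerm_zero]⟩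

lemma symmTerm_comp_perm {f : (Fin (q + 1) → SVGen × ℕ) → ℂ} (hf : IsSkew f)
    (σ : Equiv.Perm (Fin (q + 2))) (x : Fin (q + 2) → SVGen × ℕ) (i j : Fin (q + 2)) :
    symmTerm f (x ∘ σ) i j = ((Equiv.Perm.sign σ : ℤ) : ℂ) * symmTerm f x (σ i) (σ j) := by
  rcases eq_or_ne i j with rfl | h
  · simp [symmTerm]
  obtain ⟨ρ, h0, h1⟩ := exists_perm_zero_one h
  have hσ : ((Equiv.Perm.sign σ : ℤ) : ℂ) * (Equiv.Perm.sign σ : ℤ) = 1 := by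
    exact_mod_cast Int.units_coe_mul_self _
  have e : x ∘ (σ * ρ : Equiv.Perm _) = (x ∘ σ) ∘ ρ := rfl
  rw [symmTerm_eq hf (x ∘ σ) h0 h1,
    symmTerm_eq hf x (ρ := σ * ρ) (by simp [h0]) (by simp [h1]), e]
  simp only [Equiv.Perm.sign_mul, Units.val_mul, Int.cast_mul]
  linear_combination -((Equiv.Perm.sign ρ : ℤ) : ℂ) * frontTerm f ((x ∘ σ) ∘ ρ) * hσ

lemma two_mul_modeD (f : (Fin (q + 1) → SVGen × ℕ) → ℂ) (x : Fin (q + 2) → SVGen × ℕ) :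
    2 * modeD f x = ∑ i, ∑ j, symmTerm f x i j := by
  simp only [symmTerm, Finset.sum_add_distrib]
  rw [two_mul]
  congr 1
  exact Finset.sum_comm

/-- The differential of a skew-symmetric function is skew-symmetric. -/
lemma IsSkew.modeD {f : (Fin (q + 1) → SVGen × ℕ) → ℂ} (hf : IsSkew f) : IsSkew (modeD f) := by
  intro σ x
  have h : 2 * SVCA.modeD f (x ∘ σ) =
      ((Equiv.Perm.sign σ : ℤ) : ℂ) * (2 * SVCA.modeD f x) := by
    rw [two_mul_modeD, two_mul_modeD, Finset.mul_sum,
      ← Equiv.sum_comp σ fun i => ((Equiv.Perm.sign σ : ℤ) : ℂ) * ∑ j, symmTerm f x i j]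
    refine Finset.sum_congr rfl fun i _ => ?_
    rw [Finset.mul_sum,
      ← Equiv.sum_comp σ fun j => ((Equiv.Perm.sign σ : ℤ) : ℂ) * symmTerm f x (σ i) j]
    exact Finset.sum_congr rfl fun j _ => symmTerm_comp_perm hf σ x i j
  linear_combination h / 2

lemma tupleWt_cons (x : Fin q → SVGen × ℕ) (e : SVGen × ℕ) :
    tupleWt (Fin.cons e x : Fin (q + 1) → SVGen × ℕ) = modeWt e + tupleWt x := by
  simp [tupleWt, Fin.sum_univ_succ]

/-- Contraction preserves the weight. -/
lemma tupleWt_contract {x : Fin (q + 2) → SVGen × ℕ} {i j : Fin (q + 2)} (h : i < j)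
    (hc : modeCoef (x i) (x j) ≠ 0) : tupleWt (contract x i j) = tupleWt x := by
  rw [contract, tupleWt_cons, modeWt_modeBrk hc, ← tupleWt_comp_perm (frontPerm i j) x]
  simp only [tupleWt, Fin.sum_univ_succ (n := q + 1), Fin.sum_univ_succ (n := q),
    Function.comp_apply, frontPerm_succ_succ, frontPerm_zero]
  rw [show (Fin.succ 0 : Fin (q + 2)) = 1 from rfl, frontPerm_one h]
  ring

lemma modeTerm_congr {f g : (Fin (q + 1) → SVGen × ℕ) → ℂ} {x : Fin (q + 2) → SVGen × ℕ}
    (h : ∀ z, tupleWt z = tupleWt x → f z = g z) {i j : Fin (q + 2)} (hij : i < j) :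
    modeTerm f x i j = modeTerm g x i j := by
  by_cases hc : modeCoef (x i) (x j) = 0
  · simp [modeTerm, hc]
  · rw [modeTerm, modeTerm, h _ (tupleWt_contract hij hc)]

/-- The differential preserves weights. -/
lemma modeD_congr {f g : (Fin (q + 1) → SVGen × ℕ) → ℂ} {x : Fin (q + 2) → SVGen × ℕ}
    (h : ∀ z, tupleWt z = tupleWt x → f z = g z) : modeD f x = modeD g x := by
  refine Finset.sum_congr rfl fun i _ => Finset.sum_congr rfl fun j _ => ?_
  split_ifs with hij
  · exact modeTerm_congr h hij
  · rfl

lemma modeD_zero (x : Fin (q + 2) → SVGen × ℕ) :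
    modeD (fun _ : Fin (q + 1) → SVGen × ℕ => 0) x = 0 := by
  simp [modeD, modeTerm]

lemma modeD_const_mul (r : ℂ) (f : (Fin (q + 1) → SVGen × ℕ) → ℂ) (x : Fin (q + 2) → SVGen × ℕ) :
    modeD (fun z => r * f z) x = r * modeD f x := by
  simp only [modeD, Finset.mul_sum]
  refine Finset.sum_congr rfl fun i _ => Finset.sum_congr rfl fun j _ => ?_
  split_ifs
  · simp only [modeTerm]; ring
  · simp

/-- The contraction with the mode `(L, 1)`, in the last entry. -/
def insertL (f : (Fin (q + 1) → SVGen × ℕ) → ℂ) : (Fin q → SVGen × ℕ) → ℂ :=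
  fun z => f (Fin.snoc z (L, 1))

lemma IsSkew.insertL {f : (Fin (q + 1) → SVGen × ℕ) → ℂ} (hf : IsSkew f) :
    IsSkew (insertL f) := by
  intro σ x
  have e : (Fin.snoc (x ∘ σ) (L, 1) : Fin (q + 1) → SVGen × ℕ) =
      (Fin.snoc x (L, 1) : Fin (q + 1) → SVGen × ℕ) ∘
        (finSuccEquivLast.permCongr.symm (Equiv.optionCongr σ)) := by
    ext1 k
    refine Fin.lastCases ?_ (fun k => ?_) k
    · simp [Equiv.permCongr]
    · simp [Equiv.permCongr]
  rw [SVCA.insertL, e, hf]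
  simp [SVCA.insertL]

lemma modeTerm_snoc_castSucc (f : (Fin (q + 2) → SVGen × ℕ) → ℂ) (y : Fin (q + 2) → SVGen × ℕ)
    {i j : Fin (q + 2)} (h : i < j) :
    modeTerm f (Fin.snoc y (L, 1) : Fin (q + 3) → SVGen × ℕ) i.castSucc j.castSucc =
      modeTerm (insertL f) y i j := by
  have e : contract (Fin.snoc y (L, 1) : Fin (q + 3) → SVGen × ℕ) i.castSucc j.castSucc =
      Fin.snoc (contract y i j) (L, 1) := by
    rw [contract, contract, ← Fin.cons_snoc_eq_snoc_cons]
    congr 1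
    · simp
    ext1 k
    refine Fin.lastCases ?_ (fun k => ?_) k
    · simp [SVskip_castSucc_last h]
    · simp [SVskip_castSucc_castSucc h]
  simp [modeTerm, insertL, e]

lemma modeTerm_snoc_last {f : (Fin (q + 2) → SVGen × ℕ) → ℂ} (hf : IsSkew f)
    (y : Fin (q + 2) → SVGen × ℕ) (i : Fin (q + 2)) :
    modeTerm f (Fin.snoc y (L, 1) : Fin (q + 3) → SVGen × ℕ) i.castSucc (Fin.last _) =
      (-1) ^ q * (modeWt (y i) / 2) * f y := by
  have e : contract (Fin.snoc y (L, 1) : Fin (q + 3) → SVGen × ℕ) i.castSucc (Fin.last _) =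
      y ∘ i.cycleRange.symm := by
    ext1 k
    refine Fin.cases ?_ (fun k => ?_) k
    · simp [contract, modeBrk_L_one]
    · simp [contract, SVskip_last]
  have h2 : ((-1 : ℂ) ^ (i : ℕ)) * (-1) ^ (i : ℕ) = 1 := by
    rw [← mul_pow]; simp
  rw [modeTerm, e, hf]
  simp only [Fin.snoc_castSucc, Fin.snoc_last, modeCoef_L_one, Equiv.Perm.sign_symm,
    Fin.sign_cycleRange, Fin.val_castSucc, Fin.val_last, Units.val_pow_eq_pow_val, Units.val_neg,
    Units.val_one, Int.cast_pow, Int.cast_neg, Int.cast_one, pow_add]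
  linear_combination ((-1) ^ q * (modeWt (y i) / 2) * f y) * h2

/-- Cartan's formula for the contraction with `(L, 1)`, which acts on modes by their weights. -/
lemma modeD_snoc {f : (Fin (q + 2) → SVGen × ℕ) → ℂ} (hf : IsSkew f)
    (y : Fin (q + 2) → SVGen × ℕ) :
    modeD f (Fin.snoc y (L, 1) : Fin (q + 3) → SVGen × ℕ) =
      modeD (insertL f) y + (-1) ^ q * (tupleWt y / 2) * f y := by
  rw [modeD, Fin.sum_univ_castSucc]
  have h : ∀ j : Fin (q + 3), ¬ Fin.last _ < j := fun j => (Fin.le_last j).not_gt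
  simp only [h, if_false, Finset.sum_const_zero, add_zero, Fin.sum_univ_castSucc (n := q + 2),
    Fin.castSucc_lt_castSucc_iff, Fin.castSucc_lt_last, if_true, Finset.sum_add_distrib,
    modeTerm_snoc_last hf]
  congr 1
  · refine Finset.sum_congr rfl fun i _ => Finset.sum_congr rfl fun j _ => ?_
    split_ifs with hij
    · exact modeTerm_snoc_castSucc f y hij
    · rfl
  · simp only [tupleWt, Int.cast_sum, Finset.sum_div, Finset.mul_sum, Finset.sum_mul]

end Differential

section WeightZero

/-- The five modes contained in every set of six distinct modes of total weight zero. -/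
def coreModes : Finset (SVGen × ℕ) := {(L, 0), (L, 1), (Y, 0), (Y, 1), (M, 0)}

lemma two_le_modeWt {x : SVGen × ℕ} (h : x ∉ coreModes) : 2 ≤ modeWt x := by
  obtain ⟨a, n⟩ := x
  simp only [coreModes, Finset.mem_insert, Finset.mem_singleton, Prod.mk.injEq, not_or] at h
  cases a <;> simp [modeWt] at h ⊢ <;> omega

lemma modeWt_lt_two : ∀ x ∈ coreModes, modeWt x < 2 := by decide

lemma eq_of_modeWt_eq_two {x : SVGen × ℕ} (h : modeWt x = 2) : x = (L, 2) ∨ x = (M, 1) := by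
  obtain ⟨a, n⟩ := x
  cases a <;> simp [modeWt] at h ⊢ <;> omega

lemma sum_modeWt_eq (s : Finset (SVGen × ℕ)) :
    ∑ x ∈ s, modeWt x = 2 * s.card - 12 + ∑ x ∈ s \ coreModes, (modeWt x - 2) +
      ∑ x ∈ coreModes \ s, (2 - modeWt x) := by
  have h0 : ∑ x ∈ s, (modeWt x - 2) = ∑ x ∈ s, modeWt x - 2 * s.card := by
    rw [Finset.sum_sub_distrib, Finset.sum_const, nsmul_eq_mul, mul_comm]
  have h1 := Finset.sum_inter_add_sum_sdiff s coreModes fun x => modeWt x - 2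
  have h2 := Finset.sum_inter_add_sum_sdiff coreModes s fun x => modeWt x - 2
  have h3 : ∑ x ∈ coreModes, (modeWt x - 2) = -12 := by decide
  have h4 : ∑ x ∈ coreModes \ s, (2 - modeWt x) = -∑ x ∈ coreModes \ s, (modeWt x - 2) := by
    rw [← Finset.sum_neg_distrib]
    exact Finset.sum_congr rfl fun x _ => by ring
  rw [Finset.inter_comm] at h2
  linarith

lemma sum_diff_core_nonneg (s : Finset (SVGen × ℕ)) :
    0 ≤ ∑ x ∈ s \ coreModes, (modeWt x - 2) :=
  Finset.sum_nonneg fun x hx => by linarith [two_le_modeWt (Finset.mem_sdiff.1 hx).2]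

lemma sum_core_diff_nonneg (s : Finset (SVGen × ℕ)) :
    0 ≤ ∑ x ∈ coreModes \ s, (2 - modeWt x) :=
  Finset.sum_nonneg fun x hx => by linarith [modeWt_lt_two x (Finset.mem_sdiff.1 hx).1]

lemma sum_modeWt_of_card_seven {s : Finset (SVGen × ℕ)} (hs : s.card = 7) :
    ∑ x ∈ s, modeWt x ≠ 0 := by
  intro h
  have h1 := sum_modeWt_eq s
  rw [h, hs] at h1
  push_cast at h1
  linarith [sum_diff_core_nonneg s, sum_core_diff_nonneg s]

lemma eq_insert_of_card_six {s : Finset (SVGen × ℕ)} (hs : s.card = 6)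
    (h : ∑ x ∈ s, modeWt x = 0) :
    s = insert (L, 2) coreModes ∨ s = insert (M, 1) coreModes := by
  have h1 := sum_modeWt_eq s
  rw [h, hs] at h1
  push_cast at h1
  have h2 := sum_diff_core_nonneg s
  have h3 := sum_core_diff_nonneg s
  have h4 : ∑ x ∈ s \ coreModes, (modeWt x - 2) = 0 := by linarith
  have h5 : ∑ x ∈ coreModes \ s, (2 - modeWt x) = 0 := by linarith
  have hsub : coreModes ⊆ s := by
    intro x hx
    by_contra hxs
    have hpos := modeWt_lt_two x hx
    have := (Finset.sum_eq_zero_iff_of_nonneg fun y hy => by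
      linarith [modeWt_lt_two y (Finset.mem_sdiff.1 hy).1]).1 h5 x (Finset.mem_sdiff.2 ⟨hx, hxs⟩)
    linarith
  have hcard : (s \ coreModes).card = 1 := by
    rw [Finset.card_sdiff_of_subset hsub, hs]; decide
  obtain ⟨x, hx⟩ := Finset.card_eq_one.1 hcard
  have hs' : s = insert x coreModes := by
    rw [Finset.insert_eq, ← hx, Finset.sdiff_union_of_subset hsub]
  rw [hx, Finset.sum_singleton] at h4
  rcases eq_of_modeWt_eq_two (by linarith : modeWt x = 2) with rfl | rfl
  · exact Or.inl hs'
  · exact Or.inr hs'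

/-- The modes of the fundamental cycle detecting `Ω`. -/
def modesΩ : Fin 6 → SVGen × ℕ := ![(L, 0), (L, 2), (Y, 0), (Y, 1), (M, 0), (L, 1)]

/-- The modes of the fundamental cycle detecting `Θ`. -/
def modesΘ : Fin 6 → SVGen × ℕ := ![(L, 0), (Y, 0), (Y, 1), (M, 0), (M, 1), (L, 1)]

lemma exists_perm_of_image_eq {G : Type*} [DecidableEq G] {q : ℕ} {x y : Fin q → G}
    (hx : Function.Injective x) (hy : Function.Injective y)
    (h : Finset.univ.image x = Finset.univ.image y) :
    ∃ σ : Equiv.Perm (Fin q), x = y ∘ σ := by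
  have hr : Set.range x = Set.range y := by
    simpa using congrArg (fun s : Finset G => (s : Set G)) h
  refine ⟨(Equiv.ofInjective x hx).trans ((Equiv.setCongr hr).trans
    (Equiv.ofInjective y hy).symm), ?_⟩
  ext1 k
  simp [Equiv.apply_ofInjective_symm]

variable {q : ℕ}

lemma sum_image_modeWt {x : Fin q → SVGen × ℕ} (hx : Function.Injective x) :
    ∑ z ∈ Finset.univ.image x, modeWt z = tupleWt x :=
  Finset.sum_image fun _ _ _ _ h => hx h

lemma IsSkew.eq_zero_of_seven {f : (Fin 7 → SVGen × ℕ) → ℂ} (hf : IsSkew f)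
    {x : Fin 7 → SVGen × ℕ} (hx : tupleWt x = 0) : f x = 0 := by
  by_cases hi : Function.Injective x
  · refine absurd ((sum_image_modeWt hi).trans hx) (sum_modeWt_of_card_seven ?_)
    rw [Finset.card_image_of_injective _ hi, Finset.card_fin]
  · exact hf.eq_zero hi

/-- A skew-symmetric function on six modes vanishes in weight zero if it vanishes on two tuples. -/
lemma IsSkew.eq_zero_of_six {f : (Fin 6 → SVGen × ℕ) → ℂ} (hf : IsSkew f)
    (hΩ : f modesΩ = 0) (hΘ : f modesΘ = 0) {x : Fin 6 → SVGen × ℕ} (hx : tupleWt x = 0) :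
    f x = 0 := by
  by_cases hi : Function.Injective x
  · have hcard : (Finset.univ.image x).card = 6 := by
      rw [Finset.card_image_of_injective _ hi, Finset.card_fin]
    rcases eq_insert_of_card_six hcard ((sum_image_modeWt hi).trans hx) with h | h
    · obtain ⟨σ, rfl⟩ := exists_perm_of_image_eq (y := modesΩ) hi (by decide)
        (h.trans (by decide))
      rw [hf, hΩ, mul_zero]
    · obtain ⟨σ, rfl⟩ := exists_perm_of_image_eq (y := modesΘ) hi (by decide)
        (h.trans (by decide))
      rw [hf, hΘ, mul_zero]
  · exact hf.eq_zero hi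

lemma modeD_snoc_eq_zero {f : (Fin 5 → SVGen × ℕ) → ℂ} (hf : IsSkew f)
    {y : Fin 5 → SVGen × ℕ} (hy : tupleWt y = 0)
    (h : ∀ i j : Fin 5, i < j → modeCoef (y i) (y j) = 0 ∨
      ¬ Function.Injective (Fin.snoc (contract y i j) (L, 1) : Fin 5 → SVGen × ℕ)) :
    modeD f (Fin.snoc y (L, 1) : Fin 6 → SVGen × ℕ) = 0 := by
  rw [modeD_snoc hf, hy, modeD]
  simp only [Int.cast_zero, zero_div, mul_zero, zero_mul, add_zero]
  refine Finset.sum_eq_zero fun i _ => Finset.sum_eq_zero fun j _ => ?_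
  split_ifs with hij
  · rcases h i j hij with h | h
    · simp [modeTerm, h]
    · rw [modeTerm, insertL, hf.eq_zero h, mul_zero]
  · rfl

lemma modeD_modesΩ {f : (Fin 5 → SVGen × ℕ) → ℂ} (hf : IsSkew f) : modeD f modesΩ = 0 := by
  have e : modesΩ = Fin.snoc ![(L, 0), (L, 2), (Y, 0), (Y, 1), (M, 0)] (L, 1) := by decide
  rw [e]
  exact modeD_snoc_eq_zero hf (by decide) (by decide)

lemma modeD_modesΘ {f : (Fin 5 → SVGen × ℕ) → ℂ} (hf : IsSkew f) : modeD f modesΘ = 0 := by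
  have e : modesΘ = Fin.snoc ![(L, 0), (Y, 0), (Y, 1), (M, 0), (M, 1)] (L, 1) := by decide
  rw [e]
  exact modeD_snoc_eq_zero hf (by decide) (by decide)

end WeightZero

section Homotopy

variable {q : ℕ}

/-- A function on modes with finite supports is the family of values of a cochain. -/
lemma exists_onModes_eq (f : (Fin q → SVGen × ℕ) → ℂ)
    (hf : ∀ a : Fin q → SVGen, {n : Fin q → ℕ | f (fun i => (a i, n i)) ≠ 0}.Finite) :
    ∃ c : SVRaw q, onModes c = f := by
  refine ⟨fun a => ∑ n ∈ (hf a).toFinset, monomial (Finsupp.equivFunOnFinite.symm n)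
    (f (fun i => (a i, n i)) / ∏ i, ((n i).factorial : ℂ)), ?_⟩
  ext x
  rw [onModes, modeValue_apply, coeff_sum]
  simp only [coeff_monomial, EmbeddingLike.apply_eq_iff_eq, Finset.sum_ite_eq']
  have hne := prod_factorial_ne_zero fun i => (x i).2
  split_ifs with h
  · exact mul_div_cancel₀ _ hne
  · simp only [Set.Finite.mem_toFinset, Set.mem_ofPred_eq, not_not] at h
    rw [mul_zero]
    exact h.symm

lemma finite_onModes_ne_zero (c : SVRaw q) (a : Fin q → SVGen) :
    {n : Fin q → ℕ | onModes c (fun i => (a i, n i)) ≠ 0}.Finite := by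
  refine ((c a).support.finite_toSet.preimage
    (Finsupp.equivFunOnFinite.symm.injective.injOn)).subset fun n hn => ?_
  simp only [Set.mem_preimage, Finset.mem_coe, mem_support_iff]
  intro h
  exact hn (by simp [onModes, modeValue_apply, h])

/-- A cocycle is cohomologous to a cochain concentrated in weight zero. -/
lemma exists_onModes_SVd_eq {c : SVRaw (q + 2)} (hc : c ∈ SVCochain (q + 2)) (hd : SVd c = 0) :
    ∃ b ∈ SVCochain (q + 1), ∀ x, onModes (SVd b) x = if tupleWt x = 0 then 0 else onModes c x := by
  have hf := (mem_SVCochain_iff c).1 hc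
  let g : (Fin (q + 1) → SVGen × ℕ) → ℂ := fun z =>
    (-(-1) ^ q * (2 / (tupleWt z : ℂ))) * insertL (onModes c) z
  obtain ⟨b, hb⟩ := exists_onModes_eq g fun a => by
    refine ((finite_onModes_ne_zero c (Fin.snoc a L)).preimage
      (f := fun n => Fin.snoc n 1) fun n _ n' _ h => ?_).subset fun n hn => ?_
    · ext i
      simpa using congrFun h i.castSucc
    · simp only [Set.mem_preimage, Set.mem_ofPred_eq]
      have e : (fun i => ((Fin.snoc a L : Fin (q + 2) → SVGen) i,
          (Fin.snoc n 1 : Fin (q + 2) → ℕ) i)) = Fin.snoc (fun i => (a i, n i)) (L, 1) := by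
        ext1 k
        refine Fin.lastCases ?_ (fun k => ?_) k <;> simp
      rw [e]
      exact right_ne_zero_of_mul hn
  refine ⟨b, (mem_SVCochain_iff b).2 ?_, fun x => ?_⟩
  · rw [hb]
    intro σ z
    simp only [g]
    rw [tupleWt_comp_perm, hf.insertL]
    ring
  · rw [onModes_SVd, hb, modeD_congr (g := fun z =>
      (-(-1) ^ q * (2 / (tupleWt x : ℂ))) * insertL (onModes c) z) fun z hz => by
        simp only [g, hz], modeD_const_mul]
    split_ifs with hx
    · simp [hx]
    · have h0 : modeD (onModes c) (Fin.snoc x (L, 1) : Fin (q + 3) → SVGen × ℕ) = 0 := by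
        rw [← onModes_SVd, hd]
        simp [onModes]
      rw [modeD_snoc hf] at h0
      have hw : (tupleWt x : ℂ) ≠ 0 := by exact_mod_cast hx
      have h2 : ((-1 : ℂ) ^ q) * (-1) ^ q = 1 := by rw [← mul_pow]; simp
      rw [eq_neg_of_add_eq_zero_left h0]
      field_simp
      linear_combination onModes c x * h2

end Homotopy

section Generators

variable {q : ℕ}

/-- A cochain supported on one orbit of tuples, with a homogeneous value, has pure weight. -/
lemma onModes_eq_zero_of_isHomogeneous {c : SVRaw q} (hc : c ∈ SVCochain q) {t : Fin q → SVGen}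
    {d : ℕ} (ht : (c t).IsHomogeneous d)
    (h0 : ∀ a, (¬ ∃ σ : Equiv.Perm (Fin q), a = t ∘ σ) → c a = 0)
    (hd : ∑ i, modeWt (t i, 0) + 2 * d = 0) {x : Fin q → SVGen × ℕ} (hx : tupleWt x ≠ 0) :
    onModes c x = 0 := by
  by_cases h : ∃ σ : Equiv.Perm (Fin q), (fun i => (x i).1) = t ∘ σ
  · obtain ⟨σ, hσ⟩ := h
    have hy : (fun i => ((x ∘ σ.symm) i).1) = t := by
      ext1 i
      simpa using congrFun hσ (σ.symm i)
    have hwt : ∀ z : SVGen × ℕ, modeWt z = modeWt (z.1, 0) + 2 * z.2 := by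
      rintro ⟨a, n⟩
      cases a <;> simp [modeWt] <;> ring
    have hy0 : onModes c (x ∘ σ.symm) = 0 := by
      rw [onModes, hy, modeValue_apply, ht.coeff_eq_zero, mul_zero]
      intro hdeg
      apply hx
      have hdeg' : ∑ i, ((x ∘ σ.symm) i).2 = d := by
        rw [← hdeg, Finsupp.degree_eq_sum]
        rfl
      rw [← tupleWt_comp_perm σ.symm x, tupleWt]
      simp only [hwt ((x ∘ σ.symm) _), Finset.sum_add_distrib, ← Finset.mul_sum]
      rw [← hd, ← hdeg', ← hy]
      push_cast
      rfl
    have e : x = (x ∘ σ.symm) ∘ σ := by ext1 i; simp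
    rw [e, (mem_SVCochain_iff c).1 hc, hy0, mul_zero]
  · simp [onModes, h0 _ h]

lemma isHomogeneous_X_sub_X (i j : Fin q) :
    (X i - X j : MvPolynomial (Fin q) ℂ).IsHomogeneous 1 :=
  (isHomogeneous_X ℂ i).sub (isHomogeneous_X ℂ j)

lemma X_sub_X_ne_zero {i j : Fin q} (h : i ≠ j) : (X i - X j : MvPolynomial (Fin q) ℂ) ≠ 0 :=
  sub_ne_zero.2 ((X_injective (R := ℂ)).ne h)

lemma not_exists_perm_of_count_ne {a t : Fin q → SVGen}
    (h : ∑ i, (if a i = L then 1 else 0) ≠ ∑ i, if t i = L then 1 else 0) :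
    ¬ ∃ σ : Equiv.Perm (Fin q), a = t ∘ σ := by
  rintro ⟨σ, rfl⟩
  exact h (Equiv.sum_comp σ fun i => if t i = L then 1 else 0)

/-- Cochains concentrated in weight zero. -/
def WeightZero (c : SVRaw q) : Prop := ∀ x, tupleWt x ≠ 0 → onModes c x = 0

lemma mem_SVcocycles_of_weightZero {c : SVRaw 6} (hc : c ∈ SVCochain 6) (hw : WeightZero c) :
    c ∈ SVcocycles 6 := by
  refine ⟨hc, LinearMap.mem_ker.2 ?_⟩
  have hf := (mem_SVCochain_iff c).1 hc
  change SVd c = 0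
  refine onModes_ext fun x => ?_
  have h0 : onModes (0 : SVRaw 7) x = 0 := by simp [onModes]
  rw [h0, onModes_SVd]
  by_cases hx : tupleWt x = 0
  · exact hf.modeD.eq_zero_of_seven hx
  · rw [modeD_congr (g := fun _ => 0) fun z hz => hw z (hz ▸ hx), modeD_zero]

lemma onModes_add (c c' : SVRaw q) (x : Fin q → SVGen × ℕ) :
    onModes (c + c') x = onModes c x + onModes c' x := by simp [onModes]

lemma onModes_sub (c c' : SVRaw q) (x : Fin q → SVGen × ℕ) :
    onModes (c - c') x = onModes c x - onModes c' x := by simp [onModes]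

lemma onModes_smul (r : ℂ) (c : SVRaw q) (x : Fin q → SVGen × ℕ) :
    onModes (r • c) x = r * onModes c x := by simp [onModes]

lemma eq_zero_of_weightZero {c : SVRaw 6} (hc : c ∈ SVCochain 6) (hw : WeightZero c)
    (hΩ : onModes c modesΩ = 0) (hΘ : onModes c modesΘ = 0) : c = 0 := by
  refine onModes_ext fun x => ?_
  have h0 : onModes (0 : SVRaw 6) x = 0 := by simp [onModes]
  rw [h0]
  by_cases hx : tupleWt x = 0
  · exact ((mem_SVCochain_iff c).1 hc).eq_zero_of_six hΩ hΘ hx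
  · exact hw x hx

lemma onModes_of_mem_SVcoboundaries {c : SVRaw 6} (hc : c ∈ SVcoboundaries 6) :
    onModes c modesΩ = 0 ∧ onModes c modesΘ = 0 := by
  obtain ⟨b, hb, rfl⟩ := hc
  have hf := (mem_SVCochain_iff b).1 hb
  change onModes (SVd b) modesΩ = 0 ∧ onModes (SVd b) modesΘ = 0
  rw [onModes_SVd]
  exact ⟨modeD_modesΩ hf, modeD_modesΘ hf⟩

/-- Any two cochains of weight zero dual to the two fundamental cycles represent a basis of the
sixth cohomology. -/
lemma basis_of_weightZero {Ω Θ : SVRaw 6} (hΩ : Ω ∈ SVCochain 6) (hΩw : WeightZero Ω)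
    (hΘ : Θ ∈ SVCochain 6) (hΘw : WeightZero Θ) (hΩΩ : onModes Ω modesΩ ≠ 0)
    (hΩΘ : onModes Ω modesΘ = 0) (hΘΩ : onModes Θ modesΩ = 0) (hΘΘ : onModes Θ modesΘ ≠ 0) :
    (∀ c₁ c₂ : ℂ, c₁ • Ω + c₂ • Θ ∈ SVcoboundaries 6 → c₁ = 0 ∧ c₂ = 0) ∧
    (∀ γ : SVRaw 6, γ ∈ SVcocycles 6 →
      ∃ c₁ c₂ : ℂ, γ - (c₁ • Ω + c₂ • Θ) ∈ SVcoboundaries 6) := by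
  constructor
  · intro c₁ c₂ h
    have h' := onModes_of_mem_SVcoboundaries h
    simpa [onModes_add, onModes_smul, hΩΩ, hΩΘ, hΘΩ, hΘΘ] using h'
  · intro γ hγ
    obtain ⟨b, hb, hbγ⟩ := exists_onModes_SVd_eq hγ.1 (LinearMap.mem_ker.1 hγ.2)
    refine ⟨onModes γ modesΩ / onModes Ω modesΩ, onModes γ modesΘ / onModes Θ modesΘ, b, hb, ?_⟩
    change SVd b = _
    have hbc : SVd b ∈ SVCochain 6 := by
      rw [mem_SVCochain_iff, onModes_SVd]
      exact ((mem_SVCochain_iff b).1 hb).modeD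
    have hwΩ : tupleWt modesΩ = 0 := by decide
    have hwΘ : tupleWt modesΘ = 0 := by decide
    refine (sub_eq_zero.1 (eq_zero_of_weightZero (Submodule.sub_mem _ (Submodule.sub_mem _ hγ.1
      (Submodule.add_mem _ (Submodule.smul_mem _ _ hΩ) (Submodule.smul_mem _ _ hΘ))) hbc)
      (fun x hx => ?_) ?_ ?_)).symm
    · simp [onModes_sub, onModes_add, onModes_smul, hbγ, hx, hΩw x hx, hΘw x hx]
    · simp [onModes_sub, onModes_add, onModes_smul, hbγ, hwΩ, hΘΩ, hΩΩ]
    · simp [onModes_sub, onModes_add, onModes_smul, hbγ, hwΘ, hΩΘ, hΘΘ]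

lemma finrank_SVbasicH_eq_two {Ω Θ : SVRaw q} (hΩ : Ω ∈ SVcocycles q) (hΘ : Θ ∈ SVcocycles q)
    (hind : ∀ c₁ c₂ : ℂ, c₁ • Ω + c₂ • Θ ∈ SVcoboundaries q → c₁ = 0 ∧ c₂ = 0)
    (hspan : ∀ γ : SVRaw q, γ ∈ SVcocycles q →
      ∃ c₁ c₂ : ℂ, γ - (c₁ • Ω + c₂ • Θ) ∈ SVcoboundaries q) :
    Module.finrank ℂ (SVbasicH q) = 2 := by
  set B := Submodule.comap (SVcocycles q).subtype (SVcoboundaries q) with hB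
  change Module.finrank ℂ (SVcocycles q ⧸ B) = 2
  let v : Fin 2 → SVcocycles q ⧸ B := ![B.mkQ ⟨Ω, hΩ⟩, B.mkQ ⟨Θ, hΘ⟩]
  have hv : LinearIndependent ℂ v := by
    refine LinearIndependent.pair_iff.2 fun s t h => hind s t ?_
    rw [← map_smul, ← map_smul, ← map_add, Submodule.mkQ_apply,
      Submodule.Quotient.mk_eq_zero] at h
    exact h
  have hs : ⊤ ≤ Submodule.span ℂ (Set.range v) := by
    rintro z -
    obtain ⟨⟨γ, hγ⟩, rfl⟩ := B.mkQ_surjective z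
    obtain ⟨c₁, c₂, h⟩ := hspan γ hγ
    have e : B.mkQ ⟨γ, hγ⟩ = c₁ • v 0 + c₂ • v 1 := by
      change B.mkQ ⟨γ, hγ⟩ = c₁ • B.mkQ ⟨Ω, hΩ⟩ + c₂ • B.mkQ ⟨Θ, hΘ⟩
      rw [← map_smul, ← map_smul, ← map_add, Submodule.mkQ_apply, Submodule.mkQ_apply,
        Submodule.Quotient.eq]
      exact h
    rw [e]
    exact Submodule.add_mem _ (Submodule.smul_mem _ _ (Submodule.subset_span ⟨0, rfl⟩))
      (Submodule.smul_mem _ _ (Submodule.subset_span ⟨1, rfl⟩))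
  rw [Module.finrank_eq_card_basis (Module.Basis.mk hv hs), Fintype.card_fin]

end Generators

open SVGen in
/-- `H̃⁶(SV,ℂ) = ℂΩ ⊕ ℂΘ` is two-dimensional, where `Ω` is
the `6`-cochain with `Ω_{λ₁,…,λ₆}(L,L,L,Y,Y,M) = (λ₁-λ₂)(λ₁-λ₃)(λ₂-λ₃)(λ₄-λ₅)`,
`Θ` is the `6`-cochain with `Θ_{λ₁,…,λ₆}(L,L,Y,Y,M,M) = (λ₁-λ₂)(λ₃-λ₄)(λ₅-λ₆)`,
each vanishing on all tuples of generators which are not (a permutation of) the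
displayed one: `Ω` and `Θ` are `6`-cocycles, no nontrivial linear combination of
them is a `6`-coboundary, and modulo coboundaries they span the `6`-cocycles. -/
theorem statement10 (Ω Θ : SVRaw 6)
    (hΩc : Ω ∈ SVCochain 6)
    (hΩv : Ω ![L, L, L, Y, Y, M] =
      (X 0 - X 1) * (X 0 - X 2) * (X 1 - X 2) * (X 3 - X 4))
    (hΩ0 : ∀ a : Fin 6 → SVGen,
      (¬ ∃ σ : Equiv.Perm (Fin 6), a = ![L, L, L, Y, Y, M] ∘ σ) → Ω a = 0)
    (hΘc : Θ ∈ SVCochain 6)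
    (hΘv : Θ ![L, L, Y, Y, M, M] = (X 0 - X 1) * (X 2 - X 3) * (X 4 - X 5))
    (hΘ0 : ∀ a : Fin 6 → SVGen,
      (¬ ∃ σ : Equiv.Perm (Fin 6), a = ![L, L, Y, Y, M, M] ∘ σ) → Θ a = 0) :
    Ω ∈ SVcocycles 6 ∧ Θ ∈ SVcocycles 6 ∧
    (∀ c₁ c₂ : ℂ, c₁ • Ω + c₂ • Θ ∈ SVcoboundaries 6 → c₁ = 0 ∧ c₂ = 0) ∧
    (∀ γ : SVRaw 6, γ ∈ SVcocycles 6 →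
      ∃ c₁ c₂ : ℂ, γ - (c₁ • Ω + c₂ • Θ) ∈ SVcoboundaries 6) ∧
    Module.finrank ℂ (SVbasicH 6) = 2 := by
  have hΩw : WeightZero Ω := fun x hx =>
    onModes_eq_zero_of_isHomogeneous (d := 4) hΩc (by
      rw [hΩv]
      exact (((isHomogeneous_X_sub_X _ _).mul (isHomogeneous_X_sub_X _ _)).mul
        (isHomogeneous_X_sub_X _ _)).mul (isHomogeneous_X_sub_X _ _)) hΩ0 (by decide) hx
  have hΘw : WeightZero Θ := fun x hx =>
    onModes_eq_zero_of_isHomogeneous (d := 3) hΘc (by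
      rw [hΘv]
      exact ((isHomogeneous_X_sub_X _ _).mul (isHomogeneous_X_sub_X _ _)).mul
        (isHomogeneous_X_sub_X _ _)) hΘ0 (by decide) hx
  have hΩΘ : onModes Ω modesΘ = 0 := by
    rw [onModes, hΩ0 _ (not_exists_perm_of_count_ne (by decide)), map_zero]
  have hΘΩ : onModes Θ modesΩ = 0 := by
    rw [onModes, hΘ0 _ (not_exists_perm_of_count_ne (by decide)), map_zero]
  have hΩΩ : onModes Ω modesΩ ≠ 0 := by
    intro h
    rw [eq_zero_of_weightZero hΩc hΩw h hΩΘ] at hΩv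
    exact mul_ne_zero (mul_ne_zero (mul_ne_zero (X_sub_X_ne_zero (by decide))
      (X_sub_X_ne_zero (by decide))) (X_sub_X_ne_zero (by decide)))
      (X_sub_X_ne_zero (by decide)) hΩv.symm
  have hΘΘ : onModes Θ modesΘ ≠ 0 := by
    intro h
    rw [eq_zero_of_weightZero hΘc hΘw hΘΩ h] at hΘv
    exact mul_ne_zero (mul_ne_zero (X_sub_X_ne_zero (by decide)) (X_sub_X_ne_zero (by decide)))
      (X_sub_X_ne_zero (by decide)) hΘv.symm
  have hΩz := mem_SVcocycles_of_weightZero hΩc hΩw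
  have hΘz := mem_SVcocycles_of_weightZero hΘc hΘw
  obtain ⟨hind, hspan⟩ := basis_of_weightZero hΩc hΩw hΘc hΘw hΩΩ hΩΘ hΘΩ hΘΘ
  exact ⟨hΩz, hΘz, hind, hspan, finrank_SVbasicH_eq_two hΩz hΘz hind hspan⟩

end SVCA
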